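/- arXiv:2207.14270 — 4 statements merged into one kernel-verified Lean document; each statement's English description precedes it below -/
import Mathlib

section
/- A finite subset Γ ⊆ L* is left P-independent if and only if Γ = Γ_1 ∪ ⋯ ∪ Γ_r, where Γ_i ⊆ Δ(a_i) is left P-independent for each i = 1, …, r, and a_1, …, a_r ∈ L* are elements with pairwise distinct norms N(a_i). -/
/-- `δ` is a `σ`-derivation of the field `L`. -/
def IsSigmaDerivation {L : Type*} [Field L] (σ : L ≃+* L) (δ : L → L) : Prop :=
  (∀ a b : L, δ (a + b) = δ a + δ b) ∧ ∀ a b : L, δ (a * b) = σ a * δ b + δ a * b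

/-- The ring `R`, together with the embedding of constants `C : L →+* R` and the
element `X`, is the Ore extension `L[x;σ,δ]`: the twisting rule
`X * C a = C (σ a) * X + C (δ a)` holds and every element of `R` is, in a unique way,
a left `L`-linear combination of the powers of `X`. -/
structure IsOreExtension {L : Type*} [Field L] (σ : L ≃+* L) (δ : L → L)
    (R : Type*) [Ring R] (C : L →+* R) (X : R) : Prop where
  twist : ∀ a : L, X * C a = C (σ a) * X + C (δ a)
  repr_unique : ∀ r : R, ∃! f : ℕ →₀ L, r = f.sum fun n a => C a * X ^ n

/-- The degree of an Ore polynomial (`⊥` for the zero polynomial). -/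
noncomputable def IsOreExtension.deg {L : Type*} [Field L] {σ : L ≃+* L} {δ : L → L}
    {R : Type*} [Ring R] {C : L →+* R} {X : R}
    (H : IsOreExtension σ δ R C X) (r : R) : WithBot ℕ :=
  (H.repr_unique r).exists.choose.support.max

/-- `f` is a right divisor of `g` : `g = u * f` for some `u`. -/
def RDvd {R : Type*} [Ring R] (f g : R) : Prop := ∃ u, g = u * f

/-- `f` is a left divisor of `g` : `g = f * u` for some `u`. -/
def LDvd {R : Type*} [Ring R] (f g : R) : Prop := ∃ u, g = f * u

/-- `m` is a least common left multiple of the family `f`. -/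
def IsLclm {R : Type*} [Ring R] {ι : Type*} (f : ι → R) (m : R) : Prop :=
  (∀ i, RDvd (f i) m) ∧ ∀ m' : R, (∀ i, RDvd (f i) m') → RDvd m m'

/-- `m` is a least common right multiple of the family `f`. -/
def IsLcrm {R : Type*} [Ring R] {ι : Type*} (f : ι → R) (m : R) : Prop :=
  (∀ i, LDvd (f i) m) ∧ ∀ m' : R, (∀ i, LDvd (f i) m') → LDvd m m'

/-- `gcld (f, g) = 1`, i.e. `fR + gR = R`. -/
def LCoprime {R : Type*} [Ring R] (f g : R) : Prop := ∃ a b : R, f * a + g * b = 1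

/-- `gcrd (f, g) = 1`, i.e. `Rf + Rg = R`. -/
def RCoprime {R : Type*} [Ring R] (f g : R) : Prop := ∃ a b : R, a * f + b * g = 1

/-- The norm `N a = a · σ a · … · σ^{μ-1} a`. -/
def Nrm {L : Type*} [Field L] (σ : L ≃+* L) (μ : ℕ) (a : L) : L :=
  ∏ i ∈ Finset.range μ, (⇑σ)^[i] a

/-- The conjugacy class `Δ(a) = { σ c * a * c⁻¹ : c ∈ L* }`. -/
def Delta {L : Type*} [Field L] (σ : L ≃+* L) (a : L) : Set L :=
  {b : L | ∃ c : L, c ≠ 0 ∧ b = σ c * a * c⁻¹}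

/-- The finite subset `Γ ⊆ L` is left P-independent: the least common left multiple
of the linear polynomials `x - b`, `b ∈ Γ`, has degree `|Γ|`. -/
def PIndepF {L : Type*} [Field L] {σ : L ≃+* L} {δ : L → L}
    {R : Type*} [Ring R] {C : L →+* R} {X : R}
    (H : IsOreExtension σ δ R C X) (Γ : Finset L) : Prop :=
  ∃ Λ : R,
    ((∀ b ∈ Γ, RDvd (X - C b) Λ) ∧ ∀ m' : R, (∀ b ∈ Γ, RDvd (X - C b) m') → RDvd Λ m') ∧
    H.deg Λ = (Γ.card : WithBot ℕ)

section Norm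

variable {L : Type*} [Field L] (σ : L ≃+* L)

lemma Nrm_succ (n : ℕ) (b : L) : Nrm σ (n + 1) b = Nrm σ n b * (⇑σ)^[n] b :=
  Finset.prod_range_succ _ _

lemma Nrm_succ' (n : ℕ) (b : L) : Nrm σ (n + 1) b = σ (Nrm σ n b) * b := by
  simp only [Nrm, Finset.prod_range_succ', map_prod, Function.iterate_succ_apply',
    Function.iterate_zero, id_eq]

lemma Nrm_zero (b : L) : Nrm σ 0 b = 1 := Finset.prod_range_zero _

variable {σ} in
lemma Nrm_ne_zero {b : L} (hb : b ≠ 0) (n : ℕ) : Nrm σ n b ≠ 0 := by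
  induction n with
  | zero => simp [Nrm_zero]
  | succ n ih => simp [Nrm_succ', ih, hb]

lemma Nrm_div (n : ℕ) (a b : L) : Nrm σ n (a / b) = Nrm σ n a / Nrm σ n b := by
  induction n with
  | zero => simp [Nrm_zero]
  | succ n ih => rw [Nrm_succ', ih, Nrm_succ', Nrm_succ', map_div₀, div_mul_div_comm]

lemma Nrm_conj (n : ℕ) (a : L) {c : L} (hc : c ≠ 0) :
    Nrm σ n (σ c * a * c⁻¹) = (⇑σ)^[n] c * Nrm σ n a * c⁻¹ := by
  induction n with
  | zero => simp [Nrm_zero, hc]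
  | succ n ih =>
    have : σ c ≠ 0 := by simpa using hc
    rw [Nrm_succ', ih, Nrm_succ', Function.iterate_succ_apply', map_mul, map_mul, map_inv₀]
    field_simp

variable {σ} {μ : ℕ}

lemma map_Nrm (hord : ∀ a : L, (⇑σ)^[μ] a = a) {b : L} (hb : b ≠ 0) :
    σ (Nrm σ μ b) = Nrm σ μ b := by
  apply mul_right_cancel₀ hb
  rw [← Nrm_succ', Nrm_succ, hord]

lemma Nrm_add (hord : ∀ a : L, (⇑σ)^[μ] a = a) {b : L} (hb : b ≠ 0) (n : ℕ) :
    Nrm σ (n + μ) b = Nrm σ μ b * Nrm σ n b := by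
  induction n with
  | zero => simp [Nrm_zero]
  | succ n ih =>
    rw [Nat.add_right_comm, Nrm_succ', ih, Nrm_succ', map_mul, map_Nrm hord hb, mul_assoc]

lemma Nrm_eq_of_mem_Delta (hord : ∀ a : L, (⇑σ)^[μ] a = a) {a b : L} (h : b ∈ Delta σ a) :
    Nrm σ μ b = Nrm σ μ a := by
  obtain ⟨c, hc, rfl⟩ := h
  rw [Nrm_conj σ μ a hc, hord]
  field_simp

lemma exists_sum_iterate_ne_zero (hμ : 0 < μ)
    (hord' : ∀ i : ℕ, 0 < i → i < μ → ∃ a : L, (⇑σ)^[i] a ≠ a) (g : ℕ → L) (hg : g 0 ≠ 0) :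
    ∃ θ : L, ∑ i ∈ Finset.range μ, g i * (⇑σ)^[i] θ ≠ 0 := by
  by_contra! hzero
  let τ : ℕ → (L →* L) := fun i =>
    { toFun := (⇑σ)^[i]
      map_one' := iterate_map_one σ i
      map_mul' := iterate_map_mul σ i }
  have hτ : ∀ i θ, τ i θ = (⇑σ)^[i] θ := fun _ _ => rfl
  have hlt : ∀ i j : Fin μ, i < j → τ i ≠ τ j := fun i j hij he => by
    obtain ⟨a, ha⟩ := hord' (j - i) (by omega) (by omega)
    have h1 := hτ j a
    rw [← he, hτ, show (j : ℕ) = i + (j - i) by omega, Function.iterate_add_apply] at h1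
    exact ha (σ.injective.iterate _ h1).symm
  have hinj : Function.Injective fun i : Fin μ => τ i := fun i j he => by
    rcases lt_trichotomy i j with h | h | h
    · exact absurd he (hlt i j h)
    · exact h
    · exact absurd he.symm (hlt j i h)
  have hli := (linearIndependent_monoidHom L L).comp _ hinj
  rw [Fintype.linearIndependent_iff] at hli
  refine hg (hli (fun i => g i) ?_ ⟨0, hμ⟩)
  ext θ
  have := hzero θ
  rw [Finset.sum_range] at this
  simpa [hτ] using this

/-- Hilbert's Theorem 90 for the cyclic group generated by `σ`. -/
lemma mem_Delta_of_Nrm_eq (hμ : 0 < μ) (hord : ∀ a : L, (⇑σ)^[μ] a = a)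
    (hord' : ∀ i : ℕ, 0 < i → i < μ → ∃ a : L, (⇑σ)^[i] a ≠ a)
    {a b : L} (hb : b ≠ 0) (h : Nrm σ μ a = Nrm σ μ b) : b ∈ Delta σ a := by
  obtain ⟨θ, hθ⟩ := exists_sum_iterate_ne_zero hμ hord' (fun i => Nrm σ i (a / b))
    (by simp [Nrm_zero])
  set c := ∑ i ∈ Finset.range μ, Nrm σ i (a / b) * (⇑σ)^[i] θ with hc
  have hfix : σ c * (a / b) = c := by
    have h1 : σ c * (a / b) =
        ∑ i ∈ Finset.range μ, Nrm σ (i + 1) (a / b) * (⇑σ)^[i + 1] θ := by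
      rw [hc, map_sum, Finset.sum_mul]
      refine Finset.sum_congr rfl fun i _ => ?_
      rw [Nrm_succ', Function.iterate_succ_apply', map_mul]
      ring
    have h2 := Finset.sum_range_succ' (fun i => Nrm σ i (a / b) * (⇑σ)^[i] θ) μ
    rw [Finset.sum_range_succ, ← h1, ← hc, hord, Nrm_div, h,
      div_self (Nrm_ne_zero hb μ), Nrm_zero] at h2
    exact (add_right_cancel h2).symm
  refine ⟨c, hθ, ?_⟩
  field_simp at hfix ⊢
  linear_combination -hfix

end Norm

/-- `B` is the basis of the powers of `X` of the skew polynomial ring `R = L[X;σ]`, with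
`L` acting on `R` by left multiplication through `C`. -/
structure IsSkewPowerBasis {L : Type*} [Field L] (σ : L ≃+* L) {R : Type*} [Ring R]
    [Module L R] (C : L →+* R) (X : R) (B : Module.Basis ℕ L R) : Prop where
  smul_eq : ∀ (a : L) (r : R), a • r = C a * r
  basis_eq : ∀ n, B n = X ^ n
  twist : ∀ a : L, X * C a = C (σ a) * X

namespace IsSkewPowerBasis

variable {L : Type*} [Field L] {σ : L ≃+* L} {R : Type*} [Ring R]
    [Module L R] {C : L →+* R} {X : R} {B : Module.Basis ℕ L R}

lemma smul_mul (h : IsSkewPowerBasis σ C X B) (a : L) (r s : R) : a • r * s = a • (r * s) := by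
  simp only [h.smul_eq, mul_assoc]

lemma eq_sum (h : IsSkewPowerBasis σ C X B) (r : R) :
    r = ∑ i ∈ (B.repr r).support, B.repr r i • X ^ i := by
  conv_lhs => rw [← B.linearCombination_repr r]
  simp [Finsupp.linearCombination_apply, Finsupp.sum, h.basis_eq]

@[elab_as_elim]
lemma induction (h : IsSkewPowerBasis σ C X B) {P : R → Prop} (r : R) (zero : P 0)
    (add : ∀ r s, P r → P s → P (r + s)) (monomial : ∀ (a : L) (n : ℕ), P (a • X ^ n)) : P r := by
  rw [h.eq_sum r]
  exact Finset.sum_induction _ P add zero fun i _ => monomial _ _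

lemma X_mul_smul (h : IsSkewPowerBasis σ C X B) (a : L) (r : R) :
    X * a • r = σ a • (X * r) := by
  rw [h.smul_eq, h.smul_eq, ← mul_assoc, h.twist, mul_assoc]

lemma X_pow_mul_C (h : IsSkewPowerBasis σ C X B) (n : ℕ) (a : L) :
    X ^ n * C a = (⇑σ)^[n] a • X ^ n := by
  induction n with
  | zero => simp [h.smul_eq]
  | succ n ih =>
    rw [pow_succ', mul_assoc, ih, h.X_mul_smul, Function.iterate_succ_apply']

lemma repr_X_pow (h : IsSkewPowerBasis σ C X B) (n : ℕ) :
    B.repr (X ^ n) = Finsupp.single n 1 := by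
  rw [← h.basis_eq, B.repr_self]

lemma repr_X_mul (h : IsSkewPowerBasis σ C X B) (r : R) :
    B.repr (X * r) 0 = 0 ∧ ∀ k, B.repr (X * r) (k + 1) = σ (B.repr r k) := by
  induction r using h.induction with
  | zero => simp
  | add r s hr hs => simp [mul_add, hr, hs]
  | monomial a n =>
    rw [h.X_mul_smul, ← pow_succ']
    simp [h.repr_X_pow, Finsupp.single_apply, apply_ite σ]

lemma repr_X_pow_mul_add (h : IsSkewPowerBasis σ C X B) (r : R) (n k : ℕ) :
    B.repr (X ^ n * r) (n + k) = (⇑σ)^[n] (B.repr r k) := by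
  induction n with
  | zero => simp
  | succ n ih =>
    rw [pow_succ', mul_assoc, Nat.add_right_comm, (h.repr_X_mul _).2, ih,
      Function.iterate_succ_apply']

/-- The elements of degree less than `d`. -/
def degLT (B : Module.Basis ℕ L R) (d : ℕ) : Submodule L R :=
  Submodule.span L (B '' Set.Iio d)

lemma mem_degLT {d : ℕ} {r : R} : r ∈ degLT B d ↔ ∀ n, d ≤ n → B.repr r n = 0 := by
  rw [degLT, B.mem_span_image]
  simp only [Set.subset_def, Finset.mem_coe, Finsupp.mem_support_iff, Set.mem_Iio]
  exact forall_congr' fun n => ⟨fun h1 h2 => by by_contra h3; exact absurd (h1 h3) (by omega),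
    fun h1 h2 => by by_contra h3; exact h2 (h1 (by omega))⟩

lemma finrank_degLT (d : ℕ) : Module.finrank L (degLT B d) = d := by
  have hli : LinearIndependent L fun i : Fin d => B i :=
    B.linearIndependent.comp _ Fin.val_injective
  have hr : B '' Set.Iio d = Set.range fun i : Fin d => B i := by
    ext x
    simp only [Set.mem_image, Set.mem_Iio, Set.mem_range]
    exact ⟨fun ⟨i, hi, hx⟩ => ⟨⟨i, hi⟩, hx⟩, fun ⟨i, hx⟩ => ⟨i, i.2, hx⟩⟩
  rw [degLT, hr, finrank_span_eq_card hli, Fintype.card_fin]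

instance (d : ℕ) : FiniteDimensional L (degLT B d) :=
  FiniteDimensional.span_of_finite L ((Set.finite_Iio d).image B)

lemma exists_mem_degLT (r : R) : ∃ n, r ∈ degLT B n := by
  refine ⟨(B.repr r).support.sup id + 1, mem_degLT.2 fun n hn => ?_⟩
  by_contra hne
  have := Finset.le_sup (f := id) (Finsupp.mem_support_iff.2 hne)
  simp only [id_eq] at this
  omega

/-- `Λ` has degree `d`. -/
def HasDeg (B : Module.Basis ℕ L R) (Λ : R) (d : ℕ) : Prop :=
  B.repr Λ d ≠ 0 ∧ Λ ∈ degLT B (d + 1)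

lemma eq_zero_of_mul_mem_degLT (h : IsSkewPowerBasis σ C X B) {Λ u : R} {d : ℕ}
    (hΛ : HasDeg B Λ d) (hu : u * Λ ∈ degLT B d) : u = 0 := by
  by_contra hne
  have hs : (B.repr u).support.Nonempty := by
    rw [Finsupp.support_nonempty_iff]
    simpa using hne
  set m := (B.repr u).support.max' hs
  have hm : m ∈ (B.repr u).support := Finset.max'_mem _ _
  have hcoeff : B.repr (u * Λ) (m + d) = B.repr u m * (⇑σ)^[m] (B.repr Λ d) := by
    conv_lhs => rw [h.eq_sum u]
    simp only [Finset.sum_mul, h.smul_mul, map_sum, map_smul, Finsupp.finsetSum_apply,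
      Finsupp.smul_apply, smul_eq_mul]
    rw [Finset.sum_eq_single_of_mem m hm, h.repr_X_pow_mul_add]
    intro i hi hne
    have hle : i ≤ m := Finset.le_max' _ i hi
    rw [show m + d = i + (m - i + d) by omega, h.repr_X_pow_mul_add,
      mem_degLT.1 hΛ.2 _ (by omega), iterate_map_zero, mul_zero]
  rw [mem_degLT.1 hu _ (by omega), eq_comm, mul_eq_zero] at hcoeff
  rcases hcoeff with h0 | h0
  · exact Finsupp.mem_support_iff.1 hm h0
  · rw [← iterate_map_zero σ m] at h0
    exact hΛ.1 (σ.injective.iterate m h0)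

lemma exists_sub_mul_mem_degLT (h : IsSkewPowerBasis σ C X B) {Λ : R} {d : ℕ}
    (hΛ : HasDeg B Λ d) (r : R) : ∃ q, r - q * Λ ∈ degLT B d := by
  obtain ⟨n, hn⟩ := exists_mem_degLT (B := B) r
  induction n generalizing r with
  | zero => exact ⟨0, mem_degLT.2 fun k _ => by simpa using mem_degLT.1 hn k (by omega)⟩
  | succ n ih =>
    by_cases hnd : n < d
    · exact ⟨0, mem_degLT.2 fun k hk => by simpa using mem_degLT.1 hn k (by omega)⟩
    obtain ⟨e, rfl⟩ : ∃ e, n = e + d := ⟨n - d, by omega⟩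
    have hlead : (⇑σ)^[e] (B.repr Λ d) ≠ 0 := fun h0 => by
      rw [← iterate_map_zero σ e] at h0
      exact hΛ.1 (σ.injective.iterate e h0)
    set q := (B.repr r (e + d) / (⇑σ)^[e] (B.repr Λ d)) • X ^ e with hq
    obtain ⟨q', hq'⟩ := ih (r - q * Λ) (mem_degLT.2 fun k hk => by
      obtain ⟨j, rfl⟩ : ∃ j, k = e + (d + j) := ⟨k - (e + d), by omega⟩
      rw [hq, h.smul_mul, map_sub, map_smul, Finsupp.sub_apply, Finsupp.smul_apply,
        h.repr_X_pow_mul_add, smul_eq_mul]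
      rcases Nat.eq_zero_or_pos j with rfl | hj
      · rw [add_zero, div_mul_cancel₀ _ hlead, sub_self]
      · rw [mem_degLT.1 hn (e + (d + j)) (by omega), mem_degLT.1 hΛ.2 (d + j) (by omega), iterate_map_zero,
          mul_zero, sub_zero])
    exact ⟨q + q', by rwa [add_mul, ← sub_sub]⟩

/-- Right evaluation at `b`: the remainder on right division by `X - C b`. -/
noncomputable def evalAt (σ : L ≃+* L) (B : Module.Basis ℕ L R) (b : L) : R →ₗ[L] L :=
  B.constr L fun n => Nrm σ n b

lemma evalAt_X_pow (h : IsSkewPowerBasis σ C X B) (b : L) (n : ℕ) :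
    evalAt σ B b (X ^ n) = Nrm σ n b := by
  rw [← h.basis_eq, evalAt, B.constr_basis]

lemma evalAt_mul_X_sub_C (h : IsSkewPowerBasis σ C X B) (b : L) (u : R) :
    evalAt σ B b (u * (X - C b)) = 0 := by
  induction u using h.induction with
  | zero => simp
  | add r s hr hs => rw [add_mul, map_add, hr, hs, add_zero]
  | monomial a n =>
    rw [h.smul_mul, mul_sub, h.X_pow_mul_C, ← pow_succ, map_smul, map_sub, map_smul,
      h.evalAt_X_pow, h.evalAt_X_pow, Nrm_succ, smul_eq_mul, smul_eq_mul, mul_comm (Nrm σ n b),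
      sub_self, mul_zero]

lemma exists_sub_C_evalAt_eq (h : IsSkewPowerBasis σ C X B) (b : L) (r : R) :
    ∃ q, r - C (evalAt σ B b r) = q * (X - C b) := by
  induction r using h.induction with
  | zero => exact ⟨0, by simp⟩
  | add r s hr hs =>
    obtain ⟨q, hq⟩ := hr
    obtain ⟨q', hq'⟩ := hs
    exact ⟨q + q', by rw [add_mul, ← hq, ← hq', map_add, map_add]; abel⟩
  | monomial a n =>
    rw [map_smul, h.evalAt_X_pow, smul_eq_mul, map_mul, h.smul_eq, ← mul_sub]
    suffices ∃ q, X ^ n - C (Nrm σ n b) = q * (X - C b) by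
      obtain ⟨q, hq⟩ := this
      exact ⟨C a * q, by rw [hq, mul_assoc]⟩
    induction n with
    | zero => exact ⟨0, by simp [Nrm_zero]⟩
    | succ n ih =>
      obtain ⟨q, hq⟩ := ih
      refine ⟨X * q + C (σ (Nrm σ n b)), ?_⟩
      rw [add_mul, mul_assoc, ← hq, Nrm_succ', map_mul, mul_sub, mul_sub, h.twist, ← pow_succ']
      abel

lemma rdvd_iff (h : IsSkewPowerBasis σ C X B) (b : L) (r : R) :
    RDvd (X - C b) r ↔ evalAt σ B b r = 0 := by
  constructor
  · rintro ⟨u, rfl⟩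
    exact h.evalAt_mul_X_sub_C b u
  · intro h0
    obtain ⟨q, hq⟩ := h.exists_sub_C_evalAt_eq b r
    exact ⟨q, by simpa [h0] using hq⟩

/-- Simultaneous evaluation at the points of `Γ`. -/
noncomputable def evalOn (σ : L ≃+* L) (B : Module.Basis ℕ L R) (Γ : Finset L) :
    R →ₗ[L] (Γ → L) :=
  LinearMap.pi fun b => evalAt σ B b

lemma mem_ker_evalOn (h : IsSkewPowerBasis σ C X B) {Γ : Finset L} {r : R} :
    r ∈ LinearMap.ker (evalOn σ B Γ) ↔ ∀ b ∈ Γ, RDvd (X - C b) r := by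
  simp [evalOn, funext_iff, h.rdvd_iff]

lemma mul_mem_ker_evalOn (h : IsSkewPowerBasis σ C X B) {Γ : Finset L} {r : R}
    (hr : r ∈ LinearMap.ker (evalOn σ B Γ)) (q : R) :
    q * r ∈ LinearMap.ker (evalOn σ B Γ) := by
  rw [h.mem_ker_evalOn] at hr ⊢
  intro b hb
  obtain ⟨u, rfl⟩ := hr b hb
  exact ⟨q * u, (mul_assoc _ _ _).symm⟩

lemma finrank_range_evalOn (h : IsSkewPowerBasis σ C X B) {Γ : Finset L} {Λ : R} {d : ℕ}
    (hΛ : HasDeg B Λ d) (hmem : Λ ∈ LinearMap.ker (evalOn σ B Γ))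
    (hgen : ∀ r ∈ LinearMap.ker (evalOn σ B Γ), RDvd Λ r) :
    Module.finrank L (LinearMap.range (evalOn σ B Γ)) = d := by
  set f := (evalOn σ B Γ).domRestrict (degLT B d) with hf
  have hinj : Function.Injective f := by
    rw [← LinearMap.ker_eq_bot, LinearMap.ker_eq_bot']
    rintro ⟨r, hr⟩ h0
    obtain ⟨u, rfl⟩ := hgen r h0
    simp [h.eq_zero_of_mul_mem_degLT hΛ hr]
  have hrange : LinearMap.range f = LinearMap.range (evalOn σ B Γ) := by
    apply le_antisymm
    · rintro _ ⟨r, rfl⟩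
      exact ⟨r, rfl⟩
    · rintro _ ⟨r, rfl⟩
      obtain ⟨q, hq⟩ := h.exists_sub_mul_mem_degLT hΛ r
      refine ⟨⟨_, hq⟩, ?_⟩
      have := h.mul_mem_ker_evalOn hmem q
      rw [LinearMap.mem_ker] at this
      rw [hf, LinearMap.domRestrict_apply, map_sub, this, sub_zero]
  rw [← hrange, LinearMap.finrank_range_of_inj hinj, finrank_degLT]

lemma exists_generator (h : IsSkewPowerBasis σ C X B) (Γ : Finset L) :
    ∃ Λ d, HasDeg B Λ d ∧ Λ ∈ LinearMap.ker (evalOn σ B Γ) ∧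
      ∀ r ∈ LinearMap.ker (evalOn σ B Γ), RDvd Λ r := by
  classical
  have hex : ∃ n, ∃ r ∈ LinearMap.ker (evalOn σ B Γ), r ≠ 0 ∧ r ∈ degLT B n := by
    by_contra! hnone
    have hinj : Function.Injective
        ((evalOn σ B Γ).domRestrict (degLT B (Γ.card + 1))) := by
      rw [← LinearMap.ker_eq_bot, LinearMap.ker_eq_bot']
      rintro ⟨r, hr⟩ h0
      by_contra hne
      exact hnone _ r h0 (fun h' => hne (by simp [h'])) hr
    have hle := LinearMap.finrank_le_finrank_of_injective hinj
    rw [finrank_degLT, Module.finrank_fintype_fun_eq_card, Fintype.card_coe] at hle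
    omega
  obtain ⟨Λ, hΛ, hne, hlt⟩ := Nat.find_spec hex
  have hmin : ∀ m < Nat.find hex, ∀ r ∈ LinearMap.ker (evalOn σ B Γ), r ∈ degLT B m → r = 0 :=
    fun m hm r hr hrm => by
      by_contra h0
      exact Nat.find_min hex hm ⟨r, hr, h0, hrm⟩
  generalize Nat.find hex = n at hlt hmin
  cases n with
  | zero =>
    exact absurd (B.ext_elem fun n => by simpa using mem_degLT.1 hlt n (by omega)) hne
  | succ d =>
    have hdeg : HasDeg B Λ d := by
      refine ⟨fun h0 => hne (hmin d (by omega) Λ hΛ (mem_degLT.2 fun n hn => ?_)), hlt⟩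
      rcases hn.eq_or_lt with rfl | hn
      · exact h0
      · exact mem_degLT.1 hlt n hn
    refine ⟨Λ, d, hdeg, hΛ, fun r hr => ?_⟩
    obtain ⟨q, hq⟩ := h.exists_sub_mul_mem_degLT hdeg r
    exact ⟨q, sub_eq_zero.1 (hmin d (by omega) _
      (Submodule.sub_mem _ hr (h.mul_mem_ker_evalOn hΛ q)) hq)⟩

lemma exists_generator_hasDeg_iff (h : IsSkewPowerBasis σ C X B) (Γ : Finset L) :
    (∃ Λ, ((∀ b ∈ Γ, RDvd (X - C b) Λ) ∧
        ∀ m' : R, (∀ b ∈ Γ, RDvd (X - C b) m') → RDvd Λ m') ∧ HasDeg B Λ Γ.card) ↔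
      Function.Surjective (evalOn σ B Γ) := by
  simp only [← h.mem_ker_evalOn]
  have hfin : Module.finrank L (Γ → L) = Γ.card := by
    rw [Module.finrank_fintype_fun_eq_card, Fintype.card_coe]
  constructor
  · rintro ⟨Λ, ⟨hmem, hgen⟩, hdeg⟩
    rw [← LinearMap.range_eq_top]
    apply Submodule.eq_top_of_finrank_eq
    rw [h.finrank_range_evalOn hdeg hmem hgen, hfin]
  · intro hsurj
    obtain ⟨Λ, d, hdeg, hmem, hgen⟩ := h.exists_generator Γ
    have hd := h.finrank_range_evalOn hdeg hmem hgen
    rw [LinearMap.range_eq_top.2 hsurj, finrank_top, hfin] at hd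
    exact ⟨Λ, ⟨hmem, hgen⟩, hd ▸ hdeg⟩

lemma evalOn_surjective_iff (h : IsSkewPowerBasis σ C X B) (Γ : Finset L) :
    Function.Surjective (evalOn σ B Γ) ↔
      LinearIndependent L fun (b : Γ) (n : ℕ) => Nrm σ n (b : L) := by
  classical
  rw [Fintype.linearIndependent_iff, ← LinearMap.range_eq_top]
  constructor
  · intro htop g hg b
    obtain ⟨r, hr⟩ := LinearMap.range_eq_top.1 htop (Pi.single b 1)
    have hzero : ∑ c : Γ, g c • evalAt σ B (c : L) = 0 := B.ext fun n => by
      have := congrFun hg n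
      simpa [h.basis_eq, h.evalAt_X_pow] using this
    have happ := LinearMap.congr_fun hzero r
    have hval : ∀ c : Γ, evalAt σ B (c : L) r = (Pi.single b 1 : Γ → L) c :=
      fun c => congrFun hr c
    simpa [hval, Pi.single_apply] using happ
  · intro hli
    by_contra hne
    obtain ⟨f, hf, hle⟩ := Submodule.exists_le_ker_of_lt_top _ (lt_top_iff_ne_top.2 hne)
    have hf_apply : ∀ x, f x = ∑ b, f (Pi.single b 1) * x b := fun x => by
      conv_lhs => rw [pi_eq_sum_univ' x]
      simp only [map_sum, map_smul, smul_eq_mul]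
      exact Finset.sum_congr rfl fun b _ => mul_comm _ _
    have hzero := hli (fun b => f (Pi.single b 1)) (by
      ext n
      have hmem : f (evalOn σ B Γ (X ^ n)) = 0 := hle ⟨X ^ n, rfl⟩
      rw [hf_apply] at hmem
      simpa [evalOn, h.evalAt_X_pow] using hmem)
    exact hf (LinearMap.ext fun x => by
      rw [hf_apply, LinearMap.zero_apply]
      exact Finset.sum_eq_zero fun b _ => by rw [hzero b, zero_mul])

end IsSkewPowerBasis

lemma pIndepF_iff_linearIndependent {L : Type*} [Field L] {σ : L ≃+* L}
    {R : Type*} [Ring R] {C : L →+* R} {X : R}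
    (H : IsOreExtension σ (fun _ => 0) R C X) (Γ : Finset L) :
    PIndepF H Γ ↔ LinearIndependent L fun (b : Γ) (n : ℕ) => Nrm σ n (b : L) := by
  let _ : Module L R := Module.compHom R C
  have hsmul : ∀ (a : L) (r : R), a • r = C a * r := fun _ _ => rfl
  have hlc : ∀ f : ℕ →₀ L, Finsupp.linearCombination L (fun n => X ^ n) f =
      f.sum fun n a => C a * X ^ n := fun _ => rfl
  have hbij : Function.Bijective (Finsupp.linearCombination L fun n : ℕ => X ^ n) := by
    rw [Function.bijective_iff_existsUnique]
    intro r
    obtain ⟨f, hf, huniq⟩ := H.repr_unique r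
    exact ⟨f, (hlc f).trans hf.symm, fun g hg => huniq g (hg.symm.trans (hlc g))⟩
  let e := LinearEquiv.ofBijective _ hbij
  let B : Module.Basis ℕ L R := Module.Basis.ofRepr e.symm
  have h : IsSkewPowerBasis σ C X B :=
    { smul_eq := hsmul
      basis_eq := fun n => by simp [B, e]
      twist := fun a => by simpa using H.twist a }
  have hrepr : ∀ r, (H.repr_unique r).exists.choose = B.repr r := fun r => by
    have hspec := (H.repr_unique r).exists.choose_spec
    rw [← hlc] at hspec
    exact ((LinearEquiv.symm_apply_eq e).2 hspec).symm
  rw [← h.evalOn_surjective_iff, ← h.exists_generator_hasDeg_iff]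
  refine exists_congr fun Λ => and_congr_right fun _ => ?_
  rw [IsOreExtension.deg, hrepr, IsSkewPowerBasis.HasDeg, IsSkewPowerBasis.mem_degLT]
  rw [Nat.cast_withBot]
  constructor
  · intro hmax
    refine ⟨Finsupp.mem_support_iff.1 (Finset.mem_of_max hmax), fun n hn => ?_⟩
    by_contra hne
    have := Finset.le_max_of_eq (Finsupp.mem_support_iff.2 hne) hmax
    omega
  · rintro ⟨hne, hlt⟩
    apply le_antisymm
    · refine Finset.max_le fun n hn => ?_
      by_contra hcard
      rw [not_le, WithBot.coe_lt_coe] at hcard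
      exact Finsupp.mem_support_iff.1 hn (hlt n hcard)
    · exact Finset.le_max (Finsupp.mem_support_iff.2 hne)

lemma linearIndependent_Nrm_of_iUnion {L : Type*} [Field L] {σ : L ≃+* L} {μ : ℕ}
    (hord : ∀ a : L, (⇑σ)^[μ] a = a) {ι : Type*} {t : ι → L} (ht : Function.Injective t)
    {Γ : Finset L} {Γs : ι → Finset L} (hΓ : ∀ b ∈ Γ, ∃ i, b ∈ Γs i)
    (hne : ∀ i, ∀ b ∈ Γs i, b ≠ 0) (hnorm : ∀ i, ∀ b ∈ Γs i, Nrm σ μ b = t i)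
    (hli : ∀ i, LinearIndependent L fun (b : Γs i) (n : ℕ) => Nrm σ n (b : L)) :
    LinearIndependent L fun (b : Γ) (n : ℕ) => Nrm σ n (b : L) := by
  let S : Module.End L (ℕ → L) := LinearMap.funLeft L L (· + μ)
  have hspan : ∀ i, Submodule.span L (Set.range fun (b : Γs i) (n : ℕ) => Nrm σ n (b : L)) ≤
      S.eigenspace (t i) := fun i => by
    rw [Submodule.span_le]
    rintro _ ⟨b, rfl⟩
    rw [SetLike.mem_coe, Module.End.mem_eigenspace_iff]
    ext n
    simp [S, LinearMap.funLeft_apply, Nrm_add hord (hne i b b.2), hnorm i b b.2]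
  have hind : iSupIndep fun i => S.eigenspace (t i) := S.eigenspaces_iSupIndep.comp ht
  have hsigma := linearIndependent_iUnion_finite hli fun i T _ hiT =>
    (hind.disjoint_biSup hiT).mono (hspan i) (iSup₂_mono fun j _ => hspan j)
  choose f hf using fun b : Γ => hΓ b b.2
  exact hsigma.comp (fun b : Γ => ⟨f b, b, hf b⟩) fun b c hbc => by
    have := congrArg (fun x : Σ i, Γs i => (x.2 : L)) hbc
    exact Subtype.ext this

/-- Proposition 17 of the paper: a finite subset `Γ ⊆ L*` is left P-independent iff
it is the union of left P-independent subsets `Γs i ⊆ Δ(a i)` of conjugacy classes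
of nonzero elements `a i` with pairwise distinct norms. -/
theorem pindependent_union_of_classes
    {L : Type*} [Field L] (σ : L ≃+* L) (μ : ℕ) (hμ : 0 < μ)
    (hord : ∀ a : L, (⇑σ)^[μ] a = a)
    (hord' : ∀ i : ℕ, 0 < i → i < μ → ∃ a : L, (⇑σ)^[i] a ≠ a)
    {R : Type*} [Ring R] (C : L →+* R) (X : R)
    (H : IsOreExtension σ (fun _ => 0) R C X)
    (Γ : Finset L) (hΓ : ∀ b ∈ Γ, b ≠ 0) :
    PIndepF H Γ ↔
      ∃ (r : ℕ) (a : Fin r → L) (Γs : Fin r → Finset L),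
        (∀ i, a i ≠ 0) ∧
        (∀ i j, i ≠ j → Nrm σ μ (a i) ≠ Nrm σ μ (a j)) ∧
        (∀ i, ∀ b ∈ Γs i, b ∈ Delta σ (a i)) ∧
        (∀ i, PIndepF H (Γs i)) ∧
        (↑Γ : Set L) = ⋃ i, (↑(Γs i) : Set L) := by
  classical
  simp only [pIndepF_iff_linearIndependent]
  constructor
  · intro hli
    let T := Γ.image (Nrm σ μ)
    let t : Fin T.card → L := fun i => T.equivFin.symm i
    have ht : Function.Injective t := Subtype.val_injective.comp T.equivFin.symm.injective
    have hrep : ∀ i, ∃ b ∈ Γ, Nrm σ μ b = t i := fun i =>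
      Finset.mem_image.1 (T.equivFin.symm i).2
    choose a haΓ ha using hrep
    refine ⟨T.card, a, fun i => Γ.filter fun b => Nrm σ μ b = t i, fun i => hΓ _ (haΓ i),
      fun i j hij => by rw [ha, ha]; exact ht.ne hij, fun i b hb => ?_, fun i => ?_, ?_⟩
    · rw [Finset.mem_filter] at hb
      exact mem_Delta_of_Nrm_eq hμ hord hord' (hΓ b hb.1)
        ((ha i).trans hb.2.symm)
    · exact hli.comp (Set.inclusion (Finset.coe_subset.2 (Finset.filter_subset _ Γ)))
        (Set.inclusion_injective _)
    · ext b
      simp only [Finset.mem_coe, Set.mem_iUnion, Finset.mem_filter]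
      refine ⟨fun hb => ?_, fun ⟨_, hb, _⟩ => hb⟩
      exact ⟨T.equivFin ⟨Nrm σ μ b, Finset.mem_image_of_mem _ hb⟩, hb, by simp [t]⟩
  · rintro ⟨r, a, Γs, -, hdist, hmem, hli, hunion⟩
    have hiff : ∀ b, b ∈ Γ ↔ ∃ i, b ∈ Γs i := fun b => by
      rw [← Finset.mem_coe, hunion]
      simp
    exact linearIndependent_Nrm_of_iUnion hord (t := fun i => Nrm σ μ (a i))
      (fun i j hij => by by_contra hne; exact hdist i j hne hij)
      (fun b hb => (hiff b).1 hb) (fun i b hb => hΓ b ((hiff b).2 ⟨i, hb⟩))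
      (fun i b hb => Nrm_eq_of_mem_Delta hord (hmem i b hb)) hli
end

section
/- Let h ∈ K[x^μ] ⊆ R be a polynomial in the central element x^μ with coefficients in K which, regarded as a polynomial in the variable y = x^μ over K, has no roots in K. Then for every a ≥ 0, the skew polynomial g = x^a·h ∈ R has no right roots in L*, i.e. there is no α ∈ L* such that x − α right-divides g. -/
section SkewNorm

variable {L : Type*} [Field L]

/-- The truncated norm `α * σ α * ⋯ * σ^(n-1) α`. -/
def skewNorm (σ : L ≃+* L) (α : L) (n : ℕ) : L :=
  ∏ i ∈ Finset.range n, (⇑σ)^[i] α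

lemma skewNorm_succ (σ : L ≃+* L) (α : L) (n : ℕ) :
    skewNorm σ α (n + 1) = skewNorm σ α n * (⇑σ)^[n] α :=
  Finset.prod_range_succ _ n

lemma skewNorm_succ' (σ : L ≃+* L) (α : L) (n : ℕ) :
    skewNorm σ α (n + 1) = σ (skewNorm σ α n) * α := by
  simp [skewNorm, Finset.prod_range_succ', Function.iterate_succ_apply']

lemma skewNorm_ne_zero (σ : L ≃+* L) {α : L} (hα : α ≠ 0) (n : ℕ) : skewNorm σ α n ≠ 0 := by
  induction n with
  | zero => simp [skewNorm]
  | succ n ih =>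
    rw [skewNorm_succ']
    exact mul_ne_zero (by simpa using ih) hα

/-- The norm over a full period is fixed by `σ`. -/
lemma map_skewNorm_of_iterate_eq (σ : L ≃+* L) {α : L} (hα : α ≠ 0) {m : ℕ}
    (hm : (⇑σ)^[m] α = α) : σ (skewNorm σ α m) = skewNorm σ α m := by
  have h := (skewNorm_succ' σ α m).symm.trans (skewNorm_succ σ α m)
  rw [hm] at h
  exact mul_right_cancel₀ hα h

lemma skewNorm_add_mul (σ : L ≃+* L) {α : L} {m : ℕ}
    (hm : (⇑σ)^[m] α = α) (n j : ℕ) :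
    skewNorm σ α (n + m * j) = skewNorm σ α n * skewNorm σ α m ^ j := by
  have hadd : ∀ k, skewNorm σ α (k + m) = skewNorm σ α k * skewNorm σ α m := by
    intro k
    induction k with
    | zero => simp [skewNorm]
    | succ k ih =>
      rw [Nat.add_right_comm, skewNorm_succ, ih, skewNorm_succ, Function.iterate_add_apply, hm]
      ring
  induction j with
  | zero => simp
  | succ j ih => rw [Nat.mul_succ, ← Nat.add_assoc, hadd, ih, pow_succ, mul_assoc]

end SkewNorm

namespace IsOreExtension

variable {L : Type*} [Field L] {σ : L ≃+* L} {R : Type*} [Ring R] {C : L →+* R} {X : R}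

lemma X_pow_mul_C (H : IsOreExtension σ (fun _ => 0) R C X) (n : ℕ) (b : L) :
    X ^ n * C b = C ((⇑σ)^[n] b) * X ^ n := by
  induction n with
  | zero => simp
  | succ n ih =>
    have ht := H.twist ((⇑σ)^[n] b)
    rw [map_zero, add_zero] at ht
    rw [pow_succ', mul_assoc, ih, ← mul_assoc, ht, Function.iterate_succ_apply', mul_assoc]

/-- Any family of values on the powers of `X` extends to a left `L`-linear map on `R`. -/
lemma exists_addMonoidHom {δ : L → L} (H : IsOreExtension σ δ R C X) (v : ℕ → L) :
    ∃ φ : R →+ L, ∀ b n, φ (C b * X ^ n) = b * v n := by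
  let S : (ℕ →₀ L) →+ R :=
    Finsupp.liftAddHom fun n => (AddMonoidHom.mulRight (X ^ n)).comp C.toAddMonoidHom
  have hS : ∀ f : ℕ →₀ L, S f = f.sum fun n a => C a * X ^ n := fun _ => rfl
  have hbij : Function.Bijective S := by
    refine ⟨fun f g hfg => (H.repr_unique (S f)).unique (hS f) (hfg.trans (hS g)), fun r => ?_⟩
    obtain ⟨f, hf, -⟩ := H.repr_unique r
    exact ⟨f, (hS f).trans hf.symm⟩
  let e := AddEquiv.ofBijective S hbij
  refine ⟨(Finsupp.liftAddHom fun n => AddMonoidHom.mulRight (v n)).comp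
    e.symm.toAddMonoidHom, fun b n => ?_⟩
  have he : e.symm (C b * X ^ n) = Finsupp.single n b := by
    rw [AddEquiv.symm_apply_eq]
    change _ = S (Finsupp.single n b)
    rw [hS, Finsupp.sum_single_index (by simp)]
  simp [he]

/-- Right evaluation at `α`: it sends `X ^ n` to the truncated norm of `α` and kills the left
ideal generated by `X - C α`. -/
lemma exists_rightEval (H : IsOreExtension σ (fun _ => 0) R C X) (α : L) :
    ∃ φ : R →+ L, (∀ b n, φ (C b * X ^ n) = b * skewNorm σ α n) ∧
      ∀ u, φ (u * (X - C α)) = 0 := by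
  obtain ⟨φ, hφ⟩ := H.exists_addMonoidHom (skewNorm σ α)
  refine ⟨φ, hφ, fun u => ?_⟩
  obtain ⟨f, hf, -⟩ := H.repr_unique u
  rw [hf, Finsupp.sum, Finset.sum_mul, map_sum]
  refine Finset.sum_eq_zero fun n _ => ?_
  have hmul : C (f n) * X ^ n * (X - C α) =
      C (f n) * X ^ (n + 1) - C (f n * (⇑σ)^[n] α) * X ^ n := by
    rw [mul_sub, mul_assoc, ← pow_succ, mul_assoc, H.X_pow_mul_C, ← mul_assoc, ← map_mul]
  rw [hmul, map_sub, hφ, hφ, skewNorm_succ]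
  ring

end IsOreExtension

/-- Proposition 18 of the paper: if `p` is a polynomial with coefficients in the
fixed field `K = L^σ` and without roots in `K`, then for every `a ≥ 0` the skew
polynomial `g = X^a * p(X^μ)` has no right roots in `L*`. -/
theorem central_polynomial_no_right_roots
    {L : Type*} [Field L] (σ : L ≃+* L) (μ : ℕ) (hμ : 0 < μ)
    (hord : ∀ a : L, (⇑σ)^[μ] a = a)
    (hord' : ∀ i : ℕ, 0 < i → i < μ → ∃ a : L, (⇑σ)^[i] a ≠ a)
    {R : Type*} [Ring R] (C : L →+* R) (X : R)
    (H : IsOreExtension σ (fun _ => 0) R C X)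
    (p : Polynomial L) (hcoef : ∀ j : ℕ, σ (p.coeff j) = p.coeff j)
    (hnoroot : ∀ β : L, σ β = β → Polynomial.eval β p ≠ 0) (a : ℕ) :
    ∀ α : L, α ≠ 0 → ¬ RDvd (X - C α) (X ^ a * p.sum fun j b => C b * X ^ (μ * j)) := by
  intro α hα ⟨u, hu⟩
  obtain ⟨φ, hφ, hker⟩ := H.exists_rightEval α
  have hval : φ (X ^ a * p.sum fun j b => C b * X ^ (μ * j)) =
      skewNorm σ α a * p.eval (skewNorm σ α μ) := by
    rw [Polynomial.eval_eq_sum, Polynomial.sum, Polynomial.sum, Finset.mul_sum, Finset.mul_sum,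
      map_sum]
    refine Finset.sum_congr rfl fun j _ => ?_
    rw [← mul_assoc, H.X_pow_mul_C, Function.iterate_fixed (hcoef j), mul_assoc, ← pow_add, hφ,
      skewNorm_add_mul σ (hord α)]
    ring
  rw [hu, hker] at hval
  exact mul_ne_zero (skewNorm_ne_zero σ hα a)
    (hnoroot _ (map_skewNorm_of_iterate_eq σ hα (hord α))) hval.symm
end

section
/- Under the P-independence hypothesis, the following statements are equivalent: (1) gcld(ω, λ) = 1; (2) ω + λR generates R/λR as a right R-module; (3) the set {ω·x^i + λR : 0 ≤ i ≤ ν−1} is right linearly independent over L in the right L-vector space R/λR (which has dimension ν = deg λ). -/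
section FilteredModule

variable {K M : Type*} [DivisionRing K] [AddCommGroup M] [Module K M]

theorem linearCombination_eq_zero_of_filtration
    (D : ℕ → AddSubgroup M) (hmono : Monotone D)
    (hsmul : ∀ m (a : K), ∀ x ∈ D m, a • x ∈ D m) (c : ℕ → M)
    (hc : ∀ m, c m ∈ D (m + 1)) (hc' : ∀ m, c m ∉ D m) :
    ∀ (d : ℕ) (a : Fin d → K), ∑ i, a i • c i = 0 → a = 0
  | 0, a, _ => Subsingleton.elim _ _
  | d + 1, a, h => by
    rw [Fin.sum_univ_castSucc] at h
    have hmem : ∑ i : Fin d, a i.castSucc • c (i.castSucc : Fin (d + 1)) ∈ D d :=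
      sum_mem fun i _ => hsmul _ _ _ (hmono i.2 (hc i))
    have hlast : a (Fin.last d) = 0 := by
      by_contra h0
      apply hc' d
      have h1 : a (Fin.last d) • c d ∈ D d := by
        have h2 := eq_neg_of_add_eq_zero_right h
        rw [Fin.val_last] at h2
        exact h2 ▸ neg_mem hmem
      simpa [smul_smul, inv_mul_cancel₀ h0] using hsmul d (a (Fin.last d))⁻¹ _ h1
    rw [hlast, zero_smul, add_zero] at h
    have ih := linearCombination_eq_zero_of_filtration D hmono hsmul c hc hc' d
      (fun i => a i.castSucc) h
    funext i
    refine Fin.lastCases hlast (fun j => congrFun ih j) i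

theorem finrank_quotient_of_filtration
    (D : ℕ → AddSubgroup M) (hmono : Monotone D) (hbot : D 0 = ⊥) (hex : ∀ x, ∃ m, x ∈ D m)
    (hsmul : ∀ m (a : K), ∀ x ∈ D m, a • x ∈ D m) (c : ℕ → M)
    (hc : ∀ m, c m ∈ D (m + 1)) (hc' : ∀ m, c m ∉ D m)
    (hlead : ∀ m, ∀ x ∈ D (m + 1), ∃ a : K, x - a • c m ∈ D m)
    (N : Submodule K M) (d : ℕ) (hN : ∀ x ∈ N, x ∈ D d → x = 0)
    (hcN : ∀ m, d ≤ m → c m ∈ N) :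
    Module.Finite K (M ⧸ N) ∧ Module.finrank K (M ⧸ N) = d := by
  have hli : LinearIndependent K fun i : Fin d => N.mkQ (c i) := by
    rw [Fintype.linearIndependent_iff]
    intro a ha
    have h1 : ∑ i, a i • c i ∈ N := by
      rw [← Submodule.Quotient.mk_eq_zero, ← Submodule.mkQ_apply]
      simpa using ha
    have h2 : ∑ i : Fin d, a i • c i ∈ D d :=
      sum_mem fun i _ => hsmul _ _ _ (hmono i.2 (hc i))
    exact congrFun
      (linearCombination_eq_zero_of_filtration D hmono hsmul c hc hc' d a (hN _ h1 h2))
  have hspan : ∀ m, ∀ x ∈ D m, N.mkQ x ∈ Submodule.span K (Set.range fun i : Fin d =>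
      N.mkQ (c i)) := by
    intro m
    induction m with
    | zero =>
      intro x hx
      rw [hbot, AddSubgroup.mem_bot] at hx
      simp [hx]
    | succ m ih =>
      intro x hx
      obtain ⟨a, ha⟩ := hlead m x hx
      have h1 : N.mkQ x = N.mkQ (x - a • c m) + a • N.mkQ (c m) := by
        rw [← map_smul, ← map_add, sub_add_cancel]
      rw [h1]
      refine add_mem (ih _ ha) (Submodule.smul_mem _ _ ?_)
      by_cases hm : m < d
      · exact Submodule.subset_span ⟨⟨m, hm⟩, rfl⟩
      · have : N.mkQ (c m) = 0 := by simpa using hcN m (not_lt.mp hm)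
        rw [this]
        exact zero_mem _
  let b := Module.Basis.mk hli (by
    rintro y -
    obtain ⟨x, rfl⟩ := N.mkQ_surjective y
    obtain ⟨m, hm⟩ := hex x
    exact hspan m x hm)
  exact ⟨Module.Finite.of_basis b, by simpa using Module.finrank_eq_card_basis b⟩

/-- If the intersection of finitely many hyperplanes has the maximal possible codimension, then
so does the intersection of any subfamily. -/
theorem finrank_quotient_iInf_comp {ι κ : Type*} [Fintype ι] [Fintype κ]
    (N : ι → Submodule K M) (h1 : ∀ i, Module.finrank K (M ⧸ N i) = 1)
    (hN : Module.finrank K (M ⧸ ⨅ i, N i) = Fintype.card ι)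
    (k : κ → ι) (hk : Function.Injective k) :
    Module.finrank K (M ⧸ ⨅ j, N (k j)) = Fintype.card κ := by
  have hfin : ∀ i, Module.Finite K (M ⧸ N i) := fun i =>
    Module.finite_of_finrank_pos (by rw [h1 i]; exact one_pos)
  have hker : LinearMap.ker (LinearMap.pi fun i => (N i).mkQ) = ⨅ i, N i := by
    simp [LinearMap.ker_pi]
  have hker' : LinearMap.ker (LinearMap.pi fun j => (N (k j)).mkQ) = ⨅ j, N (k j) := by
    simp [LinearMap.ker_pi]
  have hsurj : Function.Surjective (LinearMap.pi fun i => (N i).mkQ) := by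
    rw [← LinearMap.range_eq_top]
    apply Submodule.eq_top_of_finrank_eq
    rw [← (LinearMap.quotKerEquivRange _).finrank_eq, hker, hN,
      Module.finrank_pi_fintype]
    simp [h1]
  have hsurj' : Function.Surjective (LinearMap.pi fun j => (N (k j)).mkQ) := by
    intro y
    classical
    obtain ⟨x, hx⟩ := hsurj fun i =>
      if h : ∃ j, k j = i then h.choose_spec ▸ y h.choose else 0
    refine ⟨x, funext fun j => ?_⟩
    have hj := congrFun hx (k j)
    have h : ∃ j', k j' = k j := ⟨j, rfl⟩
    simp only [LinearMap.pi_apply, dif_pos h] at hj ⊢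
    rw [hj]
    have : ∀ (j' : κ) (h' : k j' = k j), (h' ▸ y j' : M ⧸ N (k j)) = y j := by
      intro j' h'
      obtain rfl := hk h'
      rfl
    exact this _ _
  rw [← hker', (LinearMap.quotKerEquivOfSurjective _ hsurj').finrank_eq,
    Module.finrank_pi_fintype]
  simp [h1]

end FilteredModule

namespace IsOreExtension

variable {L : Type*} [Field L] {σ : L ≃+* L} {δ : L → L} {R : Type*} [Ring R] {C : L →+* R}
  {X : R}

/-- The additive map sending a finitely supported family of coefficients to the corresponding
Ore polynomial. -/
noncomputable def ofCoeff (C : L →+* R) (X : R) : (ℕ →₀ L) →+ R :=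
  Finsupp.liftAddHom fun n => (AddMonoidHom.mulRight (X ^ n)).comp C.toAddMonoidHom

theorem ofCoeff_apply (f : ℕ →₀ L) : ofCoeff C X f = f.sum fun n a => C a * X ^ n := rfl

theorem ofCoeff_single (n : ℕ) (a : L) : ofCoeff C X (Finsupp.single n a) = C a * X ^ n := by
  simp [ofCoeff_apply]

theorem ofCoeff_bijective (H : IsOreExtension σ δ R C X) : Function.Bijective (ofCoeff C X) := by
  constructor
  · intro f f' h
    exact (H.repr_unique (ofCoeff C X f)).unique rfl h
  · intro r
    obtain ⟨f, hf⟩ := (H.repr_unique r).exists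
    exact ⟨f, hf.symm⟩

variable (H : IsOreExtension σ δ R C X)

/-- The left coefficients of an Ore polynomial. -/
noncomputable def coeff : R ≃+ (ℕ →₀ L) := (AddEquiv.ofBijective _ H.ofCoeff_bijective).symm

theorem ofCoeff_coeff (r : R) : ofCoeff C X (H.coeff r) = r :=
  (AddEquiv.ofBijective _ H.ofCoeff_bijective).apply_symm_apply r

theorem coeff_ofCoeff (f : ℕ →₀ L) : H.coeff (ofCoeff C X f) = f :=
  (AddEquiv.ofBijective _ H.ofCoeff_bijective).symm_apply_apply f

theorem deg_eq (r : R) : H.deg r = (H.coeff r).support.max := by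
  have h := (H.repr_unique r).exists.choose_spec
  have : (H.repr_unique r).exists.choose = H.coeff r :=
    (H.repr_unique r).unique h (H.ofCoeff_coeff r).symm
  rw [deg, this]

theorem induction_on (H : IsOreExtension σ δ R C X) {P : R → Prop} (hzero : P 0)
    (hadd : ∀ r s, P r → P s → P (r + s))
    (hmono : ∀ n a, P (C a * X ^ n)) (r : R) : P r := by
  rw [← H.ofCoeff_coeff r]
  induction H.coeff r using Finsupp.induction_linear with
  | zero => simpa using hzero
  | add f g hf hg => simpa using hadd _ _ hf hg
  | single n a => simpa [ofCoeff_single] using hmono n a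

theorem coeff_monomial (n : ℕ) (a : L) : H.coeff (C a * X ^ n) = Finsupp.single n a := by
  rw [← ofCoeff_single, coeff_ofCoeff]

theorem coeff_C_mul (a : L) (r : R) (i : ℕ) : H.coeff (C a * r) i = a * H.coeff r i := by
  induction r using H.induction_on with
  | hzero => simp
  | hadd r s hr hs => simp [mul_add, hr, hs]
  | hmono n b =>
    rw [← mul_assoc, ← map_mul, coeff_monomial, coeff_monomial, Finsupp.single_apply,
      Finsupp.single_apply, mul_ite, mul_zero]

theorem coeff_X_mul (hδ : IsSigmaDerivation σ δ) (r : R) (i : ℕ) :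
    H.coeff (X * r) (i + 1) = σ (H.coeff r i) + δ (H.coeff r (i + 1)) := by
  have hδ0 : δ 0 = 0 := by simpa using hδ.1 0 0
  induction r using H.induction_on with
  | hzero => simp [hδ0]
  | hadd r s hr hs => simp [mul_add, hr, hs, hδ.1]; abel
  | hmono n b =>
    rw [← mul_assoc, H.twist, add_mul, mul_assoc, ← pow_succ', map_add H.coeff, coeff_monomial,
      coeff_monomial, coeff_monomial]
    simp only [Finsupp.add_apply, Finsupp.single_apply, add_left_inj]
    split_ifs <;> simp [hδ0]

/-- The Ore polynomials of degree less than `m`. -/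
def degLT (m : ℕ) : AddSubgroup R where
  carrier := {r | ∀ i, m ≤ i → H.coeff r i = 0}
  zero_mem' := by simp
  add_mem' := fun ha hb i hi => by simp [ha i hi, hb i hi]
  neg_mem' := fun ha i hi => by simp [ha i hi]

theorem degLT_mono : Monotone H.degLT := fun _ _ h _ hr i hi => hr i (h.trans hi)

theorem degLT_zero : H.degLT 0 = ⊥ := by
  rw [eq_bot_iff]
  intro r hr
  rw [AddSubgroup.mem_bot, ← map_eq_zero_iff H.coeff H.coeff.injective]
  ext i
  exact hr i (Nat.zero_le i)

theorem exists_mem_degLT (r : R) : ∃ m, r ∈ H.degLT m := by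
  refine ⟨(H.coeff r).support.sup id + 1, fun i hi => ?_⟩
  by_contra h
  have := Finset.le_sup (f := id) (Finsupp.mem_support_iff.mpr h)
  simp only [id] at this
  omega

theorem mem_degLT_of_succ {m : ℕ} {r : R} (hr : r ∈ H.degLT (m + 1)) (h : H.coeff r m = 0) :
    r ∈ H.degLT m := by
  intro i hi
  rcases hi.eq_or_lt with rfl | hi
  · exact h
  · exact hr i hi

theorem exists_lead {r : R} (hr : r ≠ 0) : ∃ d, r ∈ H.degLT (d + 1) ∧ H.coeff r d ≠ 0 := by
  obtain ⟨m, hm⟩ := H.exists_mem_degLT r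
  induction m with
  | zero => exact absurd (by simpa [degLT_zero] using hm) hr
  | succ m ih =>
    by_cases h : H.coeff r m = 0
    · exact ih (H.mem_degLT_of_succ hm h)
    · exact ⟨m, hm, h⟩

theorem lead_of_deg_eq {r : R} {d : ℕ} (h : H.deg r = d) :
    r ∈ H.degLT (d + 1) ∧ H.coeff r d ≠ 0 := by
  rw [deg_eq] at h
  refine ⟨fun i hi => ?_, Finsupp.mem_support_iff.mp (Finset.mem_of_max h)⟩
  by_contra hne
  have : i ≤ d := Finset.le_max_of_eq (Finsupp.mem_support_iff.mpr hne) h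
  omega

theorem C_mul_mem_degLT {m : ℕ} (a : L) {r : R} (hr : r ∈ H.degLT m) : C a * r ∈ H.degLT m :=
  fun i hi => by rw [coeff_C_mul, hr i hi, mul_zero]

theorem monomial_mem_degLT (n : ℕ) (a : L) : C a * X ^ n ∈ H.degLT (n + 1) := by
  intro i hi
  rw [coeff_monomial, Finsupp.single_eq_of_ne (by omega)]

theorem X_pow_mem_degLT (n : ℕ) : X ^ n ∈ H.degLT (n + 1) := by
  simpa using H.monomial_mem_degLT n 1

theorem coeff_X_pow (n : ℕ) : H.coeff (X ^ n) = Finsupp.single n 1 := by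
  simpa using H.coeff_monomial n 1

theorem X_pow_mul_lead (hδ : IsSigmaDerivation σ δ) {n : ℕ} {s : R} (hs : s ∈ H.degLT (n + 1))
    (m : ℕ) : X ^ m * s ∈ H.degLT (m + n + 1) ∧
      H.coeff (X ^ m * s) (m + n) = (σ : L → L)^[m] (H.coeff s n) := by
  have hδ0 : δ 0 = 0 := by simpa using hδ.1 0 0
  induction m with
  | zero => simpa using hs
  | succ m ih =>
    rw [pow_succ', mul_assoc]
    refine ⟨fun i hi => ?_, ?_⟩
    · obtain ⟨i, rfl⟩ : ∃ j, i = j + 1 := ⟨i - 1, by omega⟩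
      rw [H.coeff_X_mul hδ, ih.1 i (by omega), ih.1 (i + 1) (by omega), map_zero, hδ0, add_zero]
    · rw [show m + 1 + n = m + n + 1 by omega, H.coeff_X_mul hδ, ih.2, ih.1 _ le_rfl, hδ0,
        add_zero, Function.iterate_succ_apply']

theorem sub_monomial_mem_degLT {m : ℕ} {r : R} (hr : r ∈ H.degLT (m + 1)) :
    r - C (H.coeff r m) * X ^ m ∈ H.degLT m :=
  H.mem_degLT_of_succ (sub_mem hr (H.monomial_mem_degLT _ _)) (by simp [coeff_monomial])

theorem mul_mem_degLT (hδ : IsSigmaDerivation σ δ) {n : ℕ} {s : R} (hs : s ∈ H.degLT (n + 1)) :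
    ∀ {m : ℕ} {r : R}, r ∈ H.degLT m → r * s ∈ H.degLT (m + n)
  | 0, r, hr => by
    have : r = 0 := by simpa [degLT_zero] using hr
    simp [this]
  | m + 1, r, hr => by
    have h := mul_mem_degLT hδ hs (H.sub_monomial_mem_degLT hr)
    rw [sub_mul, mul_assoc] at h
    have h' := H.C_mul_mem_degLT (H.coeff r m) (H.X_pow_mul_lead hδ hs m).1
    have := add_mem (H.degLT_mono (by omega : m + n ≤ m + 1 + n) h)
      (H.degLT_mono (by omega : m + n + 1 ≤ m + 1 + n) h')
    rwa [sub_add_cancel] at this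

theorem coeff_mul_lead (hδ : IsSigmaDerivation σ δ) {m n : ℕ} {r s : R}
    (hr : r ∈ H.degLT (m + 1)) (hs : s ∈ H.degLT (n + 1)) :
    H.coeff (r * s) (m + n) = H.coeff r m * (σ : L → L)^[m] (H.coeff s n) := by
  have h := H.mul_mem_degLT hδ hs (H.sub_monomial_mem_degLT hr) (m + n) le_rfl
  rw [sub_mul, mul_assoc, map_sub, Finsupp.sub_apply, coeff_C_mul,
    (H.X_pow_mul_lead hδ hs m).2] at h
  exact sub_eq_zero.mp h

theorem coeff_mul_lead_ne_zero (hδ : IsSigmaDerivation σ δ) {m n : ℕ} {r s : R}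
    (hr : r ∈ H.degLT (m + 1)) (hs : s ∈ H.degLT (n + 1)) (hr0 : H.coeff r m ≠ 0)
    (hs0 : H.coeff s n ≠ 0) : H.coeff (r * s) (m + n) ≠ 0 := by
  rw [H.coeff_mul_lead hδ hr hs]
  refine mul_ne_zero hr0 fun h => hs0 (σ.injective.iterate m ?_)
  rw [h, iterate_map_zero]

theorem C_mem_degLT (a : L) : C a ∈ H.degLT 1 := by simpa using H.monomial_mem_degLT 0 a

theorem coeff_C_zero (a : L) : H.coeff (C a) 0 = a := by
  have := H.coeff_monomial 0 a
  simp only [pow_zero, mul_one] at this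
  simp [this]

/-- The left vector space structure on an Ore extension. -/
abbrev leftModule (C : L →+* R) : Module L R := Module.compHom R C

/-- The right vector space structure on an Ore extension. -/
abbrev rightModule (C : L →+* R) : Module Lᵐᵒᵖ R := Module.compHom R C.op

/-- The left ideal generated by `p`, as a left vector space. -/
def leftMultiples (C : L →+* R) (p : R) : @Submodule L R _ _ (leftModule C) :=
  letI := leftModule C
  { carrier := {r | RDvd p r}
    zero_mem' := ⟨0, by simp⟩
    add_mem' := by
      rintro _ _ ⟨u, rfl⟩ ⟨v, rfl⟩
      exact ⟨u + v, (add_mul u v p).symm⟩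
    smul_mem' := by
      rintro a _ ⟨u, rfl⟩
      exact ⟨C a * u, (mul_assoc (C a) u p).symm⟩ }

/-- The right ideal generated by `p`, as a right vector space. -/
def rightMultiples (C : L →+* R) (p : R) : @Submodule Lᵐᵒᵖ R _ _ (rightModule C) :=
  letI := rightModule C
  { carrier := {r | LDvd p r}
    zero_mem' := ⟨0, by simp⟩
    add_mem' := by
      rintro _ _ ⟨u, rfl⟩ ⟨v, rfl⟩
      exact ⟨u + v, (mul_add p u v).symm⟩
    smul_mem' := by
      rintro a _ ⟨u, rfl⟩
      exact ⟨u * C a.unop, mul_assoc p u (C a.unop)⟩ }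

theorem finrank_quotient_leftMultiples (hδ : IsSigmaDerivation σ δ) {p : R} {d : ℕ}
    (hp : p ∈ H.degLT (d + 1)) (hp0 : H.coeff p d ≠ 0) :
    letI := leftModule C
    Module.finrank L (R ⧸ leftMultiples C p) = d := by
  let _ := leftModule C
  let c : ℕ → R := fun m => if m < d then X ^ m else X ^ (m - d) * p
  have hc : ∀ m, c m ∈ H.degLT (m + 1) ∧ H.coeff (c m) m ≠ 0 := by
    intro m
    by_cases hm : m < d
    · simp only [c, if_pos hm]
      exact ⟨H.X_pow_mem_degLT m, by simp [coeff_X_pow]⟩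
    · obtain ⟨l, rfl⟩ := Nat.exists_eq_add_of_le' (not_lt.mp hm)
      simp only [c, if_neg hm, Nat.add_sub_cancel]
      refine ⟨(H.X_pow_mul_lead hδ hp l).1,
        H.coeff_mul_lead_ne_zero hδ (H.X_pow_mem_degLT l) hp ?_ hp0⟩
      simp [coeff_X_pow]
  refine (finrank_quotient_of_filtration H.degLT H.degLT_mono H.degLT_zero H.exists_mem_degLT
    (fun m a x hx => H.C_mul_mem_degLT a hx) c (fun m => (hc m).1)
    (fun m h => (hc m).2 (h m le_rfl)) ?_ _ d ?_ ?_).2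
  · intro m x hx
    refine ⟨H.coeff x m / H.coeff (c m) m, ?_⟩
    refine H.mem_degLT_of_succ (sub_mem hx (H.C_mul_mem_degLT _ (hc m).1)) ?_
    change H.coeff (x - C _ * c m) m = 0
    rw [map_sub, Finsupp.sub_apply, coeff_C_mul, div_mul_cancel₀ _ (hc m).2, sub_self]
  · rintro _ ⟨u, rfl⟩ hx
    by_contra hne
    obtain ⟨m, hm, hm0⟩ := H.exists_lead (left_ne_zero_of_mul hne)
    exact H.coeff_mul_lead_ne_zero hδ hm hp hm0 hp0 (hx _ (by omega))
  · intro m hm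
    exact ⟨X ^ (m - d), by simp [c, not_lt.mpr hm]⟩

theorem mul_C_mem_degLT (hδ : IsSigmaDerivation σ δ) {m : ℕ} {r : R} (hr : r ∈ H.degLT m)
    (a : L) : r * C a ∈ H.degLT m :=
  H.mul_mem_degLT hδ (n := 0) (H.C_mem_degLT a) hr

theorem finrank_quotient_rightMultiples (hδ : IsSigmaDerivation σ δ) {p : R} {d : ℕ}
    (hp : p ∈ H.degLT (d + 1)) (hp0 : H.coeff p d ≠ 0) :
    letI := rightModule C
    Module.Finite Lᵐᵒᵖ (R ⧸ rightMultiples C p) ∧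
      Module.finrank Lᵐᵒᵖ (R ⧸ rightMultiples C p) = d := by
  let _ := rightModule C
  let c : ℕ → R := fun m => if m < d then X ^ m else p * X ^ (m - d)
  have hc : ∀ m, c m ∈ H.degLT (m + 1) ∧ H.coeff (c m) m ≠ 0 := by
    intro m
    by_cases hm : m < d
    · simp only [c, if_pos hm]
      exact ⟨H.X_pow_mem_degLT m, by simp [coeff_X_pow]⟩
    · obtain ⟨l, rfl⟩ := Nat.exists_eq_add_of_le (not_lt.mp hm)
      simp only [c, if_neg hm, Nat.add_sub_cancel_left]
      refine ⟨H.degLT_mono (by omega) (H.mul_mem_degLT hδ (H.X_pow_mem_degLT l) hp),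
        H.coeff_mul_lead_ne_zero hδ hp (H.X_pow_mem_degLT l) hp0 ?_⟩
      simp [coeff_X_pow]
  refine finrank_quotient_of_filtration H.degLT H.degLT_mono H.degLT_zero H.exists_mem_degLT
    (fun m a x hx => H.mul_C_mem_degLT hδ hx a.unop) c (fun m => (hc m).1)
    (fun m h => (hc m).2 (h m le_rfl)) ?_ _ d ?_ ?_
  · intro m x hx
    obtain ⟨a, ha⟩ := σ.surjective.iterate m (H.coeff x m / H.coeff (c m) m)
    refine ⟨MulOpposite.op a, ?_⟩
    refine H.mem_degLT_of_succ (sub_mem hx (H.mul_C_mem_degLT hδ (hc m).1 a)) ?_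
    change H.coeff (x - c m * C a) m = 0
    have h := H.coeff_mul_lead hδ (n := 0) (hc m).1 (H.C_mem_degLT a)
    rw [add_zero, coeff_C_zero, ha, mul_div_cancel₀ _ (hc m).2] at h
    rw [map_sub, Finsupp.sub_apply, h, sub_self]
  · rintro _ ⟨u, rfl⟩ hx
    by_contra hne
    obtain ⟨m, hm, hm0⟩ := H.exists_lead (right_ne_zero_of_mul hne)
    exact H.coeff_mul_lead_ne_zero hδ hp hm hp0 hm0 (hx _ (by omega))
  · intro m hm
    exact ⟨X ^ (m - d), by simp [c, not_lt.mpr hm]⟩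

theorem sum_X_pow_mul_C_eq_zero (H : IsOreExtension σ δ R C X)
    (hδ : IsSigmaDerivation σ δ) {d : ℕ} (a : Fin d → L)
    (h : ∑ i : Fin d, X ^ (i : ℕ) * C (a i) = 0) : a = 0 := by
  let _ := rightModule C
  have := linearCombination_eq_zero_of_filtration H.degLT H.degLT_mono
    (fun m (a : Lᵐᵒᵖ) x hx => H.mul_C_mem_degLT hδ hx a.unop) (fun m => X ^ m)
    H.X_pow_mem_degLT (fun m h => by simpa [coeff_X_pow] using h m le_rfl) d
    (fun i => MulOpposite.op (a i)) h
  funext i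
  exact MulOpposite.op_injective (congrFun this i)

theorem X_sub_C_lead (a : L) :
    X - C a ∈ H.degLT 2 ∧ H.coeff (X - C a) 1 ≠ 0 := by
  have hX := H.X_pow_mem_degLT 1
  have hX' := H.coeff_X_pow 1
  rw [pow_one] at hX hX'
  refine ⟨sub_mem hX (H.degLT_mono one_le_two (H.C_mem_degLT a)), ?_⟩
  rw [map_sub, Finsupp.sub_apply, hX', H.C_mem_degLT a 1 le_rfl]
  simp

theorem leftMultiples_lclm {ι : Type*} {f : ι → R} {m : R} (h : IsLclm f m) :
    letI := leftModule C
    leftMultiples C m = ⨅ i, leftMultiples C (f i) := by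
  let _ := leftModule C
  ext r
  rw [Submodule.mem_iInf]
  constructor
  · rintro ⟨u, rfl⟩ i
    obtain ⟨v, rfl⟩ := h.1 i
    exact ⟨u * v, (mul_assoc _ _ _).symm⟩
  · exact h.2 r

/-- A subfamily of a P-independent family is P-independent: its least common left multiple has
the maximal possible degree. -/
theorem lclm_lead_of_comp (hδ : IsSigmaDerivation σ δ) {n ν : ℕ} {α : Fin n → L} {Λ lam : R}
    (hΛ : IsLclm (fun i => X - C (α i)) Λ) (hdeg : H.deg Λ = n)
    {k : Fin ν → Fin n} (hk : Function.Injective k)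
    (hlam : IsLclm (fun j => X - C (α (k j))) lam) :
    lam ∈ H.degLT (ν + 1) ∧ H.coeff lam ν ≠ 0 := by
  let _ := leftModule C
  obtain ⟨hΛn, hΛ0⟩ := H.lead_of_deg_eq hdeg
  have hlam0 : lam ≠ 0 := by
    rintro rfl
    obtain ⟨u, hu⟩ := hlam.2 Λ fun j => hΛ.1 (k j)
    simp [hu] at hΛ0
  obtain ⟨d, hd, hd0⟩ := H.exists_lead hlam0
  have h1 := finrank_quotient_iInf_comp (fun i => leftMultiples C (X - C (α i)))
    (fun i => H.finrank_quotient_leftMultiples hδ (H.X_sub_C_lead (α i)).1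
      (H.X_sub_C_lead (α i)).2)
    (by rw [← leftMultiples_lclm hΛ, H.finrank_quotient_leftMultiples hδ hΛn hΛ0,
      Fintype.card_fin]) k hk
  rw [← leftMultiples_lclm hlam, H.finrank_quotient_leftMultiples hδ hd hd0,
    Fintype.card_fin] at h1
  exact h1 ▸ ⟨hd, hd0⟩

theorem lCoprime_iff_linearIndependent (hδ : IsSigmaDerivation σ δ) {p w : R} {d : ℕ}
    (hp : p ∈ H.degLT (d + 1)) (hp0 : H.coeff p d ≠ 0) :
    LCoprime w p ↔ ∀ a : Fin d → L,
      (∃ b : R, (∑ i : Fin d, w * X ^ (i : ℕ) * C (a i)) = p * b) → ∀ i, a i = 0 := by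
  let _ := rightModule C
  obtain ⟨hfin, hrank⟩ := H.finrank_quotient_rightMultiples hδ hp hp0
  constructor
  · rintro ⟨u, v, huv⟩ a ⟨b, hb⟩
    set q := ∑ i : Fin d, X ^ (i : ℕ) * C (a i) with hq
    have hwq : w * q = p * b := by
      rw [← hb, hq, Finset.mul_sum]
      simp only [mul_assoc]
    refine congrFun (H.sum_X_pow_mul_C_eq_zero hδ a ?_)
    by_contra hq0
    obtain ⟨m, hm, hm0⟩ := H.exists_lead hq0
    have hmd : m < d := by
      by_contra hmd
      have hq' : q ∈ H.degLT d := sum_mem fun i _ => H.mul_C_mem_degLT hδ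
        (H.degLT_mono i.2 (H.X_pow_mem_degLT i)) _
      exact hm0 (hq' m (not_lt.mp hmd))
    obtain ⟨hfin', hrank'⟩ := H.finrank_quotient_rightMultiples hδ hm hm0
    let ψ : R →ₗ[Lᵐᵒᵖ] R :=
      { toFun := fun r => w * r
        map_add' := mul_add w
        map_smul' := fun a r => (mul_assoc w r (C a.unop)).symm }
    let φ : R →ₗ[Lᵐᵒᵖ] R ⧸ rightMultiples C p := (rightMultiples C p).mkQ.comp ψ
    have hφ : rightMultiples C q ≤ LinearMap.ker φ := by
      rintro _ ⟨r, rfl⟩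
      refine (Submodule.Quotient.mk_eq_zero _).mpr ⟨b * r, ?_⟩
      change w * (q * r) = p * (b * r)
      rw [← mul_assoc, hwq, mul_assoc]
    have hsurj : Function.Surjective ((rightMultiples C q).liftQ φ hφ) := by
      intro y
      obtain ⟨z, rfl⟩ := (rightMultiples C p).mkQ_surjective y
      refine ⟨(rightMultiples C q).mkQ (u * z), ?_⟩
      refine (Submodule.Quotient.eq _).mpr ⟨-(v * z), ?_⟩
      change w * (u * z) - z = p * -(v * z)
      have : z = w * (u * z) + p * (v * z) := by
        rw [← mul_assoc, ← mul_assoc, ← add_mul, huv, one_mul]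
      rw [mul_neg, eq_neg_iff_add_eq_zero, sub_add_eq_add_sub, ← this, sub_self]
    have hle := LinearMap.finrank_le_finrank_of_surjective hsurj
    exact hmd.not_ge (hrank.symm.trans_le (hle.trans hrank'.le))
  · intro h
    have hli : LinearIndependent Lᵐᵒᵖ fun i : Fin d =>
        (rightMultiples C p).mkQ (w * X ^ (i : ℕ)) := by
      rw [Fintype.linearIndependent_iff]
      intro a ha i
      refine MulOpposite.unop_injective (h (fun i => (a i).unop) ?_ i)
      simp only [← map_smul, ← map_sum] at ha
      exact (Submodule.Quotient.mk_eq_zero _).mp ha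
    have htop := hli.span_eq_top_of_card_eq_finrank' (by rw [hrank, Fintype.card_fin])
    have h1 : (rightMultiples C p).mkQ 1 ∈ Submodule.span Lᵐᵒᵖ (Set.range fun i : Fin d =>
        (rightMultiples C p).mkQ (w * X ^ (i : ℕ))) := htop ▸ Submodule.mem_top
    obtain ⟨a, ha⟩ := (Submodule.mem_span_range_iff_exists_fun _).mp h1
    simp only [← map_smul, ← map_sum] at ha
    obtain ⟨b, hb⟩ := (Submodule.Quotient.eq _).mp ha
    refine ⟨∑ i : Fin d, X ^ (i : ℕ) * C (a i).unop, -b, ?_⟩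
    have hb' : (∑ i : Fin d, w * X ^ (i : ℕ) * C (a i).unop) - 1 = p * b := hb
    rw [Finset.mul_sum, mul_neg, ← hb']
    simp only [mul_assoc]
    abel

end IsOreExtension

theorem lCoprime_iff_forall_exists {R : Type*} [Ring R] {w p : R} :
    LCoprime w p ↔ ∀ z : R, ∃ a b : R, z = w * a + p * b := by
  constructor
  · rintro ⟨a, b, h⟩ z
    exact ⟨a * z, b * z, by rw [← mul_assoc, ← mul_assoc, ← add_mul, h, one_mul]⟩
  · intro h
    obtain ⟨a, b, hab⟩ := h 1
    exact ⟨a, b, hab.symm⟩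

/-- Proposition 20 of the paper: the following are equivalent: `gcld (ω, lam) = 1`;
the class of `ω` generates `R/(lam R)` as a right `R`-module; the classes of
`ω * X^i`, `0 ≤ i ≤ ν - 1`, are right linearly independent over `L` in `R/(lam R)`. -/
theorem evaluator_generates_quotient_tfae
    {L : Type*} [Field L] (σ : L ≃+* L) (δ : L → L) (hδ : IsSigmaDerivation σ δ)
    {R : Type*} [Ring R] (C : L →+* R) (X : R) (H : IsOreExtension σ δ R C X)
    (F : Subfield L) (n : ℕ) (α : Fin n → L) (hα : Function.Injective α)
    (g : R) (hg0 : g ≠ 0)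
    (hginv : ∀ a : R, ∃ b : R, a * g = g * b) (hginv' : ∀ a : R, ∃ b : R, g * a = b * g)
    (hcop : ∀ i, RCoprime (X - C (α i)) g)
    (hp : Fin n → R) (hpdeg : ∀ i, H.deg (hp i) < H.deg g)
    (hpinv : ∀ i, ∃ w : R, (X - C (α i)) * hp i - 1 = w * g)
    (η : Fin n → L) (hη : ∀ i, η i ≠ 0)
    (e : Fin n → L) (heF : ∀ i, e i ∈ F)
    (ν : ℕ) (k : Fin ν → Fin n) (hk : Function.Injective k)
    (hek : ∀ j, e (k j) ≠ 0) (hesupp : ∀ i, (∀ j, k j ≠ i) → e i = 0)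
    (lam : R) (hlam : IsLclm (fun j : Fin ν => X - C (α (k j))) lam)
    (ρ : Fin ν → R) (hρ : ∀ j, lam = ρ j * (X - C (α (k j))))
    (ω : R) (hω : ω = ∑ j, ρ j * C (η (k j)) * C (e (k j)))
    (Pind : ∃ Λ : R, IsLclm (fun i : Fin n => X - C (α i)) Λ ∧ H.deg Λ = (n : WithBot ℕ)) :
    (LCoprime ω lam ↔ ∀ z : R, ∃ a b : R, z = ω * a + lam * b) ∧
    (LCoprime ω lam ↔
      ∀ a : Fin ν → L,
        (∃ b : R, (∑ i : Fin ν, ω * X ^ (i : ℕ) * C (a i)) = lam * b) → ∀ i, a i = 0) := by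
  obtain ⟨Λ, hΛ, hdeg⟩ := Pind
  obtain ⟨hν, hν0⟩ := H.lclm_lead_of_comp hδ hΛ hdeg hk hlam
  exact ⟨lCoprime_iff_forall_exists, H.lCoprime_iff_linearIndependent hδ hν hν0⟩
end

section
/- For every i ≥ 0 and every 1 ≤ j ≤ ν, the j-th coordinate of ω·x^i + λR with respect to the right L-basis {ρ_{k_1} + λR, …, ρ_{k_ν} + λR} of R/λR is N_{−i}(α_{k_j})·σ^{−i}(η_{k_j})·σ^{−i}(e_j); that is, ω·x^i + λR = Σ_{j=1}^{ν} ρ_{k_j}·N_{−i}(α_{k_j})·σ^{−i}(η_{k_j})·σ^{−i}(e_j) + λR. -/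
/-- The negative partial norm `N_{-i}(a) = a · σ⁻¹ a · … · σ^{-i+1} a`. -/
def Nneg {L : Type*} [Field L] (σ : L ≃+* L) (i : ℕ) (a : L) : L :=
  ∏ t ∈ Finset.range i, (⇑σ.symm)^[t] a

theorem Nneg_succ {L : Type*} [Field L] (σ : L ≃+* L) (i : ℕ) (a : L) :
    Nneg σ (i + 1) a = a * σ.symm (Nneg σ i a) := by
  simp only [Nneg, Finset.prod_range_succ', Function.iterate_succ_apply',
    Function.iterate_zero_apply, map_prod, mul_comm]

/-- Multiplication by a power of `X` modulo `lam R`, for `lam` right divisible by `X - C a`. -/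
theorem IsOreExtension.exists_mul_C_mul_X_pow {L : Type*} [Field L] {σ : L ≃+* L}
    {R : Type*} [Ring R] {C : L →+* R} {X : R} (H : IsOreExtension σ (fun _ => 0) R C X)
    {lam r : R} {a : L} (h : lam = r * (X - C a)) (c : L) (i : ℕ) :
    ∃ b : R, r * C c * X ^ i = r * C (Nneg σ i a * (⇑σ.symm)^[i] c) + lam * b := by
  induction i with
  | zero => exact ⟨0, by simp [Nneg]⟩
  | succ i ih =>
    obtain ⟨b, hb⟩ := ih
    set d := Nneg σ i a * (⇑σ.symm)^[i] c
    have htw : C d * X = X * C (σ.symm d) := by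
      simp [H.twist]
    have hd : Nneg σ (i + 1) a * (⇑σ.symm)^[i + 1] c = a * σ.symm d := by
      rw [Nneg_succ, Function.iterate_succ_apply', map_mul, mul_assoc]
    refine ⟨C (σ.symm d) + b * X, ?_⟩
    rw [hd, pow_succ, ← mul_assoc, hb, add_mul, mul_assoc r, htw, map_mul C a, h]
    noncomm_ring

/-- Lemma 22 of the paper: the coordinates of `ω * X^i` modulo `lam R` with respect
to the right `L`-basis given by the classes of `ρ j` are
`N_{-i}(α (k j)) * σ^{-i}(η (k j)) * σ^{-i}(e (k j))`. -/
theorem evaluator_coordinates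
    {L : Type*} [Field L] (σ : L ≃+* L) (μ : ℕ) (hμ : 0 < μ)
    (hord : ∀ a : L, (⇑σ)^[μ] a = a)
    (hord' : ∀ i : ℕ, 0 < i → i < μ → ∃ a : L, (⇑σ)^[i] a ≠ a)
    {R : Type*} [Ring R] (C : L →+* R) (X : R)
    (H : IsOreExtension σ (fun _ => 0) R C X)
    (F : Subfield L) (n : ℕ) (α : Fin n → L) (hα : Function.Injective α)
    (g : R) (hg0 : g ≠ 0)
    (hginv : ∀ a : R, ∃ b : R, a * g = g * b) (hginv' : ∀ a : R, ∃ b : R, g * a = b * g)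
    (hcop : ∀ i, RCoprime (X - C (α i)) g)
    (η : Fin n → L) (hη : ∀ i, η i ≠ 0)
    (e : Fin n → L) (heF : ∀ i, e i ∈ F)
    (ν : ℕ) (k : Fin ν → Fin n) (hk : Function.Injective k)
    (hek : ∀ j, e (k j) ≠ 0) (hesupp : ∀ i, (∀ j, k j ≠ i) → e i = 0)
    (lam : R) (hlam : IsLclm (fun j : Fin ν => X - C (α (k j))) lam)
    (ρ : Fin ν → R) (hρ : ∀ j, lam = ρ j * (X - C (α (k j))))
    (ω : R) (hω : ω = ∑ j, ρ j * C (η (k j)) * C (e (k j)))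
    (Pind : ∃ Λ : R, IsLclm (fun i : Fin n => X - C (α i)) Λ ∧ H.deg Λ = (n : WithBot ℕ))
    :
    ∀ i : ℕ, ∃ b : R,
      ω * X ^ i =
        (∑ j, ρ j *
          C (Nneg σ i (α (k j)) * (⇑σ.symm)^[i] (η (k j)) * (⇑σ.symm)^[i] (e (k j)))) +
        lam * b := by
  intro i
  choose b hb using fun j =>
    H.exists_mul_C_mul_X_pow (hρ j) (η (k j) * e (k j)) i
  refine ⟨∑ j, b j, ?_⟩
  rw [hω, Finset.sum_mul, Finset.mul_sum, ← Finset.sum_add_distrib]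
  refine Finset.sum_congr rfl fun j _ => ?_
  rw [mul_assoc (ρ j), ← map_mul, hb j, iterate_map_mul, ← mul_assoc (Nneg _ _ _)]
end
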